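/- For all real numbers γ* > 0 and d_* > 0 there exists a constant C_1 > 0 such that for every convex polygon Ω of diameter 1 satisfying G1 (γ < γ*) and G2 (|v_i − v_j| > d_* for all i ≠ j), for every x in the interior of Ω, and for all indices a ≠ b: (t_{a−1}(x) + t_a(x)) · (t_{b−1}(x) + t_b(x)) / (r_a(x)² · r_b(x)) ≤ C_1 · (Σ_{j=1}^n w_j(x))². -/

import Mathlib

open EuclideanGeometry Metric Real

noncomputable section

abbrev E2 := EuclideanSpace ℝ (Fin 2)

structure ConvexPolygon (n : ℕ) [NeZero n] where
  v : Fin n → E2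
  hn : 3 ≤ n
  extreme : ∀ i, v i ∈ Set.extremePoints ℝ (convexHull ℝ (Set.range v))
  boundary : frontier (convexHull ℝ (Set.range v)) = ⋃ i, segment ℝ (v i) (v (i + 1))

namespace ConvexPolygon

variable {n : ℕ} [NeZero n] (P : ConvexPolygon n)

def region : Set E2 := convexHull ℝ (Set.range P.v)

def edge (i : Fin n) : Set E2 := segment ℝ (P.v i) (P.v (i + 1))

def inradius : ℝ := sSup {r : ℝ | ∃ c : E2, Metric.closedBall c r ⊆ P.region}

def G1 (γs : ℝ) : Prop := Metric.diam P.region / P.inradius < γs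

def G2 (ds : ℝ) : Prop := ∀ i j : Fin n, i ≠ j → ds < dist (P.v i) (P.v j)

def interiorAngle (i : Fin n) : ℝ := ∠ (P.v (i - 1)) (P.v i) (P.v (i + 1))

def angleAt (i : Fin n) (x : E2) : ℝ := ∠ (P.v i) x (P.v (i + 1))

def r (i : Fin n) (x : E2) : ℝ := dist x (P.v i)

def t (i : Fin n) (x : E2) : ℝ := Real.tan (P.angleAt i x / 2)

def w (i : Fin n) (x : E2) : ℝ := (P.t (i - 1) x + P.t i x) / P.r i x

def lambda (i : Fin n) (x : E2) : ℝ := P.w i x / ∑ j, P.w j x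

def nonadjacent (i j : Fin n) : Prop := i ≠ j ∧ i ≠ j + 1 ∧ j ≠ i + 1

def SepProp (h : ℝ) : Prop :=
  ∀ x ∈ P.region,
    (∀ i j k : Fin n, i ≠ j → j ≠ k → i ≠ k →
      ¬((Metric.closedBall x h ∩ P.edge i).Nonempty ∧
        (Metric.closedBall x h ∩ P.edge j).Nonempty ∧
        (Metric.closedBall x h ∩ P.edge k).Nonempty)) ∧
    (∀ i j : Fin n, nonadjacent i j →
      ¬((Metric.closedBall x h ∩ P.edge i).Nonempty ∧
        (Metric.closedBall x h ∩ P.edge j).Nonempty))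

end ConvexPolygon

/-! Planar cross and dot products in coordinates. -/

def crs (u w : E2) : ℝ := u 0 * w 1 - u 1 * w 0
def dt (u w : E2) : ℝ := u 0 * w 0 + u 1 * w 1

lemma inner_eq_dt (u w : E2) : inner ℝ u w = dt u w := by
  simp [PiLp.inner_apply, Fin.sum_univ_two, dt, mul_comm]

lemma norm_sq_eq_dt (u : E2) : ‖u‖ ^ 2 = dt u u := by
  rw [← real_inner_self_eq_norm_sq, inner_eq_dt]

lemma dt_le_norm (u w : E2) : dt u w ≤ ‖u‖ * ‖w‖ := by
  rw [← inner_eq_dt]; exact real_inner_le_norm u w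

lemma angle_facts (u w : E2) :
    0 ≤ sin (InnerProductGeometry.angle u w) ∧
    cos (InnerProductGeometry.angle u w) * (‖u‖ * ‖w‖) = dt u w ∧
    sin (InnerProductGeometry.angle u w) * (‖u‖ * ‖w‖) = |crs u w| := by
  have h0 := InnerProductGeometry.sin_angle_nonneg u w
  have h1 : cos (InnerProductGeometry.angle u w) * (‖u‖ * ‖w‖) = dt u w := by
    rw [InnerProductGeometry.cos_angle_mul_norm_mul_norm, inner_eq_dt]
  refine ⟨h0, h1, ?_⟩
  have hn : 0 ≤ sin (InnerProductGeometry.angle u w) * (‖u‖ * ‖w‖) := by positivity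
  rw [← abs_of_nonneg hn, ← sq_eq_sq_iff_abs_eq_abs]
  have h2 := sin_sq_add_cos_sq (InnerProductGeometry.angle u w)
  have h3 : (sin (InnerProductGeometry.angle u w) * (‖u‖ * ‖w‖)) ^ 2
      = ‖u‖ ^ 2 * ‖w‖ ^ 2 - (dt u w) ^ 2 := by
    rw [← h1]; linear_combination (‖u‖ ^ 2 * ‖w‖ ^ 2) * h2
  rw [h3, norm_sq_eq_dt, norm_sq_eq_dt]; simp only [dt, crs]; ring

lemma tan_half_mul (θ : ℝ) : tan (θ / 2) * (1 + cos θ) = sin θ := by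
  have h1 : sin θ = 2 * sin (θ / 2) * cos (θ / 2) := by rw [← sin_two_mul]; ring_nf
  have h2 : cos θ = 2 * cos (θ / 2) ^ 2 - 1 := by rw [← cos_two_mul]; ring_nf
  rw [h1, h2, tan_eq_sin_div_cos]
  by_cases h : cos (θ / 2) = 0
  · simp [h]
  · field_simp; ring

lemma tan_half_nonneg (u w : E2) : 0 ≤ tan (InnerProductGeometry.angle u w / 2) := by
  apply tan_nonneg_of_nonneg_of_le_pi_div_two
  · have := InnerProductGeometry.angle_nonneg u w; linarith
  · have := InnerProductGeometry.angle_le_pi u w; linarith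

/-- Upper bound on the half-angle tangent. -/
lemma tan_half_upper (u w : E2) (s : ℝ) (hs : 0 < s) (hs1 : s ≤ 2)
    (h : 0 ≤ cos (InnerProductGeometry.angle u w) ∨ s ≤ sin (InnerProductGeometry.angle u w)) :
    tan (InnerProductGeometry.angle u w / 2) ≤ 2 / s := by
  have hk := tan_half_mul (InnerProductGeometry.angle u w)
  have h0 := tan_half_nonneg u w
  have hsin := sin_le_one (InnerProductGeometry.angle u w)
  have hcos := neg_one_le_cos (InnerProductGeometry.angle u w)
  have hsc := sin_sq_add_cos_sq (InnerProductGeometry.angle u w)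
  set t := tan (InnerProductGeometry.angle u w / 2)
  set S := sin (InnerProductGeometry.angle u w)
  set C := cos (InnerProductGeometry.angle u w)
  rw [le_div_iff₀ hs]
  rcases h with h | h
  · nlinarith
  · have hS : 0 < S := by linarith
    have : t * S = 1 - C := by
      have : (t * S) * S = (1 - C) * S := by
        have : S ^ 2 = (1 + C) * (1 - C) := by linarith
        calc (t * S) * S = t * S ^ 2 := by ring
          _ = (t * (1 + C)) * (1 - C) := by rw [this]; ring
          _ = _ := by rw [hk]; ring
      exact mul_right_cancel₀ hS.ne' this
    nlinarith

/-- Lower bound on the half-angle tangent. -/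
lemma tan_half_lower (u w : E2) (τ : ℝ) (hτ : 0 < τ) (hτ1 : τ ≤ 1)
    (hpos : 0 < sin (InnerProductGeometry.angle u w))
    (h : τ * (cos (InnerProductGeometry.angle u w) - 1 / 3)
      ≤ sin (InnerProductGeometry.angle u w)) :
    τ / 6 ≤ tan (InnerProductGeometry.angle u w / 2) := by
  have hk := tan_half_mul (InnerProductGeometry.angle u w)
  have hsin := sin_le_one (InnerProductGeometry.angle u w)
  have h0 := tan_half_nonneg u w
  have hcos := neg_one_le_cos (InnerProductGeometry.angle u w)
  have hcos1 := cos_le_one (InnerProductGeometry.angle u w)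
  have hsc := sin_sq_add_cos_sq (InnerProductGeometry.angle u w)
  set t := tan (InnerProductGeometry.angle u w / 2)
  set S := sin (InnerProductGeometry.angle u w)
  set C := cos (InnerProductGeometry.angle u w)
  by_cases h1 : 2 / 3 ≤ C
  · nlinarith
  · push Not at h1
    by_cases h2 : 0 ≤ C
    · have : 1 / 2 ≤ S := by nlinarith
      nlinarith
    · push Not at h2
      have : t * S = 1 - C := by
        have : (t * S) * S = (1 - C) * S := by
          have : S ^ 2 = (1 + C) * (1 - C) := by linarith
          calc (t * S) * S = t * S ^ 2 := by ring
            _ = (t * (1 + C)) * (1 - C) := by rw [this]; ring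
            _ = _ := by rw [hk]; ring
        exact mul_right_cancel₀ hpos.ne' this
      nlinarith

/-- Scalar core of the upper bound. -/
lemma scalar_core (d ρ u1 w1 δ e1 e2 C1 C2 m1 m2 : ℝ) (hd : 0 < d) (hd1 : d ≤ 1)
    (hρ : 0 < ρ) (hρ1 : ρ ≤ 1)
    (hu : (3 * d / 4) ^ 2 ≤ u1 ^ 2 + δ ^ 2) (hw : (3 * d / 4) ^ 2 ≤ w1 ^ 2 + δ ^ 2)
    (hδ0 : 0 ≤ δ) (hδ : δ ≤ ρ * d / 8) (hu1 : u1 < 0) (hw1 : 0 < w1)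
    (he1 : |e1| ≤ ρ * d / 8) (he2 : |e2| ≤ ρ * d / 8)
    (hC1 : |C1| ≤ 1)
    (hm2 : |m2| ≤ 1)
    (hmu : m1 * (u1 - e1) + m2 * (δ - e2) ≤ 0)
    (hmw : m1 * (w1 - e1) + m2 * (δ - e2) ≤ 0)
    (hD : 0 < δ - e2) (hC2 : C2 ≤ δ - e2 - ρ) (hmC : m1 * C1 + m2 * C2 ≤ -ρ) : False := by
  rw [abs_le] at *
  have hrd : ρ * d ≤ d := by nlinarith
  have hw2 : d / 2 + d / 8 ≤ w1 := by nlinarith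
  have hu2 : u1 ≤ -(d / 2 + d / 8) := by nlinarith
  set D := δ - e2 with hDd
  have hD2 : D ≤ ρ * d / 4 := by linarith
  have ha : d / 2 ≤ w1 - e1 := by linarith
  have hb : u1 - e1 ≤ -(d / 2) := by linarith
  have k1 : m1 * (d / 2) + m2 * D ≤ 0 := by
    rcases le_total 0 m1 with h | h
    · nlinarith
    · nlinarith
  have k2 : -m1 * (d / 2) + m2 * D ≤ 0 := by
    rcases le_total 0 m1 with h | h
    · nlinarith
    · nlinarith
  have hm2' : m2 ≤ 0 := by
    by_contra hh
    push Not at hh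
    nlinarith [mul_pos hh hD]
  have hm2D : -(m2 * D) ≤ ρ * d / 4 := by
    have := mul_le_mul_of_nonneg_right hm2.1 hD.le
    linarith
  have k3 : m1 ≤ ρ / 2 := le_of_mul_le_mul_right (by linarith : m1 * (d / 2) ≤ ρ / 2 * (d / 2)) (by linarith)
  have k4 : -m1 ≤ ρ / 2 := le_of_mul_le_mul_right (by linarith : -m1 * (d / 2) ≤ ρ / 2 * (d / 2)) (by linarith)
  have hrd2 : ρ * d ≤ ρ := mul_le_of_le_one_right hρ.le hd1
  have hC2' : C2 ≤ 0 := by linarith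
  have k5 : 0 ≤ m2 * C2 := mul_nonneg_of_nonpos_of_nonpos hm2' hC2'
  have k6 : -(ρ / 2) ≤ m1 * C1 := by
    rcases le_total 0 C1 with h | h
    · have := mul_le_mul_of_nonneg_right k4 h
      have := mul_le_mul_of_nonneg_left hC1.2 hρ.le
      nlinarith only [this, ‹-m1 * C1 ≤ _›]
    · have := mul_le_mul_of_nonpos_right k3 h
      have := mul_le_mul_of_nonneg_left hC1.1 hρ.le
      nlinarith only [this, ‹ρ / 2 * C1 ≤ _›]
  linarith

lemma dt_frame (ν z y : E2) (hν : dt ν ν = 1) :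
    dt z y = crs ν z * crs ν y + dt ν z * dt ν y := by
  simp only [dt, crs] at *
  linear_combination (-(z 0 * y 0 + z 1 * y 1)) * hν

lemma crs_frame (ν z y : E2) (hν : dt ν ν = 1) :
    crs z y = dt ν z * crs ν y - crs ν z * dt ν y := by
  simp only [dt, crs] at *
  linear_combination (-(z 0 * y 1 - z 1 * y 0)) * hν

lemma abs_dt_le (ν z : E2) (hν : dt ν ν = 1) : |dt ν z| ≤ ‖z‖ := by
  apply abs_le_of_sq_le_sq _ (norm_nonneg _)
  rw [norm_sq_eq_dt, dt_frame ν z z hν]; nlinarith [sq_nonneg (crs ν z)]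

lemma abs_crs_le (ν z : E2) (hν : dt ν ν = 1) : |crs ν z| ≤ ‖z‖ := by
  apply abs_le_of_sq_le_sq _ (norm_nonneg _)
  rw [norm_sq_eq_dt, dt_frame ν z z hν]; nlinarith [sq_nonneg (dt ν z)]

lemma dt_sub (ν z y : E2) : dt ν (z - y) = dt ν z - dt ν y := by
  simp [dt]; ring

lemma crs_sub (ν z y : E2) : crs ν (z - y) = crs ν z - crs ν y := by
  simp [crs]; ring

/-- Angles of edges not incident to a nearby vertex stay away from `π`. -/
lemma upper_geo (d ρ : ℝ) (hd : 0 < d) (hd1 : d ≤ 1) (hρ : 0 < ρ) (hρ1 : ρ ≤ 1)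
    (u w e C ν μ : E2) (hν : dt ν ν = 1) (hμ : dt μ μ = 1)
    (he : ‖e‖ ≤ ρ * d / 8) (hue : d ≤ ‖u - e‖) (hwe : d ≤ ‖w - e‖) (huw : d ≤ ‖u - w‖)
    (hu1 : ‖u‖ ≤ 1) (hw1 : ‖w‖ ≤ 1) (hC : ‖C‖ ≤ 1)
    (hνuw : dt ν u = dt ν w) (hνu : 0 ≤ dt ν u) (hνe : 0 < dt ν u - dt ν e)
    (hνC : dt ν C ≤ dt ν u - dt ν e - ρ)
    (hμu : dt μ (u - e) ≤ 0) (hμw : dt μ (w - e) ≤ 0) (hμC : dt μ C ≤ -ρ) :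
    tan (InnerProductGeometry.angle u w / 2) ≤ 2 / (ρ * d / 8 * d) := by
  have hrd : ρ * d ≤ d := mul_le_of_le_one_left hd.le hρ1
  have hun : 3 * d / 4 ≤ ‖u‖ := by linarith [norm_sub_le u e]
  have hwn : 3 * d / 4 ≤ ‖w‖ := by linarith [norm_sub_le w e]
  apply tan_half_upper
  · positivity
  · nlinarith [mul_le_of_le_one_right hd.le hd1, mul_le_mul_of_nonneg_right hrd hd.le]
  · by_contra hcon
    push Not at hcon
    obtain ⟨hc, hs⟩ := hcon
    obtain ⟨hs0, hcos, hsin⟩ := angle_facts u w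
    have hpos : 0 < ‖u‖ * ‖w‖ := by
      have : 0 < 3 * d / 4 := by positivity
      apply mul_pos <;> linarith
    have hle : ‖u‖ * ‖w‖ ≤ 1 := mul_le_one₀ hu1 (norm_nonneg _) hw1
    have hdt : dt u w < 0 := by rw [← hcos]; exact mul_neg_of_neg_of_pos hc hpos
    have hcr : |crs u w| ≤ ρ * d / 8 * d := by
      rw [← hsin]; nlinarith
    have hcr2 : |crs u w| = dt ν u * ‖u - w‖ := by
      have h1 : ‖u - w‖ ^ 2 = (crs ν (u - w)) ^ 2 := by
        rw [norm_sq_eq_dt, dt_frame ν _ _ hν, dt_sub, hνuw]; ring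
      have h2 : ‖u - w‖ = |crs ν (u - w)| := by
        rw [← abs_of_nonneg (norm_nonneg (u - w))]
        exact (sq_eq_sq_iff_abs_eq_abs _ _).1 h1
      rw [h2, crs_frame ν u w hν, ← hνuw, crs_sub]
      calc |dt ν u * crs ν w - crs ν u * dt ν u| = |dt ν u * (crs ν u - crs ν w)| := by
            rw [← abs_neg]; ring_nf
        _ = _ := by rw [abs_mul, abs_of_nonneg hνu]
    have hδ : dt ν u ≤ ρ * d / 8 := by
      rw [hcr2] at hcr
      have : dt ν u * d ≤ ρ * d / 8 * d := by nlinarith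
      exact le_of_mul_le_mul_right this hd
    have hprod : crs ν u * crs ν w < 0 := by
      rw [dt_frame ν u w hν, ← hνuw] at hdt; nlinarith [mul_self_nonneg (dt ν u)]
    have hsu : (3 * d / 4) ^ 2 ≤ (crs ν u) ^ 2 + (dt ν u) ^ 2 := by
      have : (3 * d / 4) ^ 2 ≤ ‖u‖ ^ 2 := by gcongr
      rw [norm_sq_eq_dt, dt_frame ν _ _ hν] at this; linarith
    have hsw : (3 * d / 4) ^ 2 ≤ (crs ν w) ^ 2 + (dt ν u) ^ 2 := by
      have : (3 * d / 4) ^ 2 ≤ ‖w‖ ^ 2 := by gcongr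
      rw [norm_sq_eq_dt, dt_frame ν _ _ hν, ← hνuw] at this; linarith
    have he1 := (abs_crs_le ν e hν).trans he
    have he2 := (abs_dt_le ν e hν).trans he
    have hC1 := (abs_crs_le ν C hν).trans hC
    have hμn : ‖μ‖ = 1 := by
      have := norm_sq_eq_dt μ
      rw [hμ] at this
      exact (pow_eq_one_iff_of_nonneg (norm_nonneg _) two_ne_zero).1 this
    have hm2 := (abs_dt_le ν μ hν).trans hμn.le
    rw [dt_frame ν _ _ hν, dt_sub, crs_sub] at hμu hμw
    rw [dt_frame ν _ _ hν] at hμC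
    rw [← hνuw] at hμw
    rcases mul_neg_iff.1 hprod with ⟨h1, h2⟩ | ⟨h1, h2⟩
    · exact scalar_core d ρ _ _ _ _ _ _ _ _ _ hd hd1 hρ hρ1 hsw hsu hνu hδ h2 h1 he1 he2 hC1 hm2
        hμw hμu hνe hνC hμC
    · exact scalar_core d ρ _ _ _ _ _ _ _ _ _ hd hd1 hρ hρ1 hsu hsw hνu hδ h1 h2 he1 he2 hC1 hm2
        hμu hμw hνe hνC hμC

/-- One neighbour is seen under a non-small angle: single neighbour version. -/
lemma lower_one (d τ : ℝ) (hτ : 0 < τ) (hτ1 : τ ≤ 1)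
    (e p : E2) (he0 : 0 < ‖e‖) (he : ‖e‖ ≤ d / 4) (hp : d ≤ ‖p‖) (hc : crs e p ≠ 0)
    (h : τ * dt e p < |crs e p|) :
    τ / 6 ≤ tan (InnerProductGeometry.angle e (p + e) / 2) := by
  obtain ⟨hs0, hcos, hsin⟩ := angle_facts e (p + e)
  have hpn : 3 * ‖e‖ ≤ ‖p + e‖ := by
    have := norm_sub_le (p + e) e
    rw [add_sub_cancel_right] at this; linarith
  have hS : 0 < ‖e‖ * ‖p + e‖ := by apply mul_pos he0; linarith
  have h1 : crs e (p + e) = crs e p := by simp [crs]; ring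
  have h2 : dt e (p + e) = dt e p + ‖e‖ ^ 2 := by rw [norm_sq_eq_dt]; simp [dt]; ring
  rw [h1] at hsin
  rw [h2] at hcos
  have h3 : ‖e‖ ^ 2 ≤ 1 / 3 * (‖e‖ * ‖p + e‖) := by nlinarith
  apply tan_half_lower _ _ τ hτ hτ1
  · have : 0 < |crs e p| := abs_pos.2 hc
    rw [← hsin] at this
    exact pos_of_mul_pos_left this hS.le
  · refine le_of_mul_le_mul_right ?_ hS
    rw [hsin]
    have : τ * (cos (InnerProductGeometry.angle e (p + e)) - 1 / 3) * (‖e‖ * ‖p + e‖)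
      = τ * (dt e p + ‖e‖ ^ 2 - 1 / 3 * (‖e‖ * ‖p + e‖)) := by rw [← hcos]; ring
    rw [this]
    have := mul_le_mul_of_nonneg_left h3 hτ.le
    nlinarith

/-- Points satisfying the two support inequalities lie in the cone. -/
lemma cone_bound (τ : ℝ) (e p q ν μ z : E2) (hν : dt ν ν = 1) (hμ : dt μ μ = 1)
    (hpq : crs p q ≠ 0) (hνq : dt ν q = 0) (hνp : dt ν p ≤ 0) (hμp : dt μ p = 0) (hμq : dt μ q ≤ 0)
    (hp : |crs e p| ≤ τ * dt e p) (hq : |crs e q| ≤ τ * dt e q)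
    (hνz : dt ν z ≤ 0) (hμz : dt μ z ≤ 0) : |crs e z| ≤ τ * dt e z := by
  have hνp' : dt ν p < 0 := by
    refine lt_of_le_of_ne hνp fun h => hpq ?_
    rw [crs_frame ν p q hν, h, hνq]; ring
  have hμq' : dt μ q < 0 := by
    refine lt_of_le_of_ne hμq fun h => hpq ?_
    rw [crs_frame μ p q hμ, h, hμp]; ring
  obtain ⟨α, β, h0, h1⟩ : ∃ α β : ℝ, z 0 = α * p 0 + β * q 0 ∧ z 1 = α * p 1 + β * q 1 := by
    refine ⟨crs z q / crs p q, crs p z / crs p q, ?_, ?_⟩ <;> field_simp <;> simp only [crs] <;> ring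
  have hα : 0 ≤ α := by
    have : dt ν z = α * dt ν p + β * dt ν q := by simp only [dt, h0, h1]; ring
    rw [hνq] at this
    by_contra hh; push Not at hh
    nlinarith [mul_pos_of_neg_of_neg hh hνp']
  have hβ : 0 ≤ β := by
    have : dt μ z = α * dt μ p + β * dt μ q := by simp only [dt, h0, h1]; ring
    rw [hμp] at this
    by_contra hh; push Not at hh
    nlinarith [mul_pos_of_neg_of_neg hh hμq']
  have k1 : crs e z = α * crs e p + β * crs e q := by simp only [crs, h0, h1]; ring
  have k2 : dt e z = α * dt e p + β * dt e q := by simp only [dt, h0, h1]; ring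
  rw [k1, k2]
  refine (abs_add_le _ _).trans ?_
  rw [abs_mul, abs_mul, abs_of_nonneg hα, abs_of_nonneg hβ]
  have := mul_le_mul_of_nonneg_left hp hα
  have := mul_le_mul_of_nonneg_left hq hβ
  linarith

/-- Angles of the two edges incident to a nearby vertex cannot both be small. -/
lemma lower_geo (d ρ : ℝ) (hρ : 0 < ρ) (hρ1 : ρ ≤ 1)
    (e p q ν μ C : E2) (hν : dt ν ν = 1) (hμ : dt μ μ = 1)
    (he : ‖e‖ ≤ d / 4) (hp : d ≤ ‖p‖) (hq : d ≤ ‖q‖)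
    (hpq : crs p q ≠ 0) (hνq : dt ν q = 0) (hνp : dt ν p ≤ 0) (hμp : dt μ p = 0) (hμq : dt μ q ≤ 0)
    (hνe : 0 < dt ν e) (hμe : 0 < dt μ e)
    (hball : ∀ z : E2, ‖z - C‖ ≤ ρ → dt ν z ≤ 0 ∧ dt μ z ≤ 0 ∧ ‖z‖ ≤ 1) :
    ρ / 12 ≤ tan (InnerProductGeometry.angle e (p + e) / 2)
      + tan (InnerProductGeometry.angle e (q + e) / 2) := by
  have he0 : 0 < ‖e‖ := by
    rw [norm_pos_iff]; rintro rfl; simp [dt] at hνe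
  have n1 := tan_half_nonneg e (p + e)
  have n2 := tan_half_nonneg e (q + e)
  have hcq : crs e q ≠ 0 := by
    intro h
    rw [crs_frame ν e q hν, hνq] at h
    have h2 : crs ν q = 0 := by
      rcases mul_eq_zero.1 (by linarith : dt ν e * crs ν q = 0) with h' | h'
      · linarith
      · exact h'
    apply hpq; rw [crs_frame ν p q hν, hνq, h2]; ring
  have hcp : crs e p ≠ 0 := by
    intro h
    rw [crs_frame μ e p hμ, hμp] at h
    have h2 : crs μ p = 0 := by
      rcases mul_eq_zero.1 (by linarith : dt μ e * crs μ p = 0) with h' | h'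
      · linarith
      · exact h'
    apply hpq; rw [crs_frame μ p q hμ, hμp, h2]; ring
  by_cases h1 : ρ / 2 * dt e p < |crs e p|
  · have := lower_one d (ρ / 2) (by positivity) (by linarith) e p he0 he hp hcp h1
    linarith
  by_cases h2 : ρ / 2 * dt e q < |crs e q|
  · have := lower_one d (ρ / 2) (by positivity) (by linarith) e q he0 he hq hcq h2
    linarith
  exfalso
  push Not at h1 h2
  set f : E2 := !₂[-(e 1), e 0] with hf
  have hff : ‖f‖ = ‖e‖ := by
    have : ‖f‖ ^ 2 = ‖e‖ ^ 2 := by rw [norm_sq_eq_dt, norm_sq_eq_dt]; simp [dt, hf]; ring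
    exact (pow_left_inj₀ (norm_nonneg _) (norm_nonneg _) two_ne_zero).1 this
  have key : ∀ s : ℝ, |s| = ρ / ‖e‖ → |crs e C + s * ‖e‖ ^ 2| ≤ ρ / 2 * ‖e‖ := by
    intro s hs
    have hb := hball (C + s • f) (by
      rw [add_sub_cancel_left, norm_smul, Real.norm_eq_abs, hs, hff]; field_simp; rfl)
    have := cone_bound (ρ / 2) e p q ν μ (C + s • f) hν hμ hpq hνq hνp hμp hμq h1 h2 hb.1 hb.2.1
    have h3 : crs e (C + s • f) = crs e C + s * ‖e‖ ^ 2 := by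
      rw [norm_sq_eq_dt]; simp [crs, dt, hf]; ring
    rw [h3] at this
    refine this.trans ?_
    have h4 := dt_le_norm e (C + s • f)
    have : dt e (C + s • f) ≤ ‖e‖ := h4.trans (mul_le_of_le_one_right he0.le hb.2.2)
    nlinarith
  have hq0 : 0 ≤ ρ / ‖e‖ := by positivity
  have ka := key (ρ / ‖e‖) (abs_of_nonneg hq0)
  have kb := key (-(ρ / ‖e‖)) (by rw [abs_neg, abs_of_nonneg hq0])
  have hx : ρ / ‖e‖ * ‖e‖ ^ 2 = ρ * ‖e‖ := by field_simp
  rw [neg_mul, hx] at kb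
  rw [hx] at ka
  rw [abs_le] at ka kb
  have : 0 < ρ * ‖e‖ := by positivity
  linarith [ka.2, kb.1]

lemma dt_smul (ν z : E2) (s : ℝ) : dt ν (s • z) = s * dt ν z := by
  simp [dt]; ring

lemma dt_add (ν z y : E2) : dt ν (z + y) = dt ν z + dt ν y := by
  simp [dt]; ring

lemma dt_smul_left (ν z : E2) (s : ℝ) : dt (s • ν) z = s * dt ν z := by
  simp [dt]; ring

namespace ConvexPolygon

variable {n : ℕ} [NeZero n] (P : ConvexPolygon n)

lemma convex_region : Convex ℝ P.region := convex_convexHull ℝ _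

lemma v_mem (i : Fin n) : P.v i ∈ P.region := subset_convexHull ℝ _ ⟨i, rfl⟩

lemma isBounded_region : Bornology.IsBounded P.region :=
  (isBounded_convexHull).2 (Set.finite_range P.v).isBounded

lemma edge_frontier (i : Fin n) {y : E2} (hy : y ∈ segment ℝ (P.v i) (P.v (i + 1))) :
    y ∉ interior P.region := by
  have : y ∈ frontier P.region := by
    rw [show frontier P.region = _ from P.boundary]
    exact Set.mem_iUnion.2 ⟨i, hy⟩
  exact this.2

/-- Supporting line of an edge. -/
lemma exists_normal (x : E2) (hx : x ∈ interior P.region) (i : Fin n) :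
    ∃ ν : E2, dt ν ν = 1 ∧ dt ν (P.v i) = dt ν (P.v (i + 1)) ∧
      (∀ y ∈ P.region, dt ν y ≤ dt ν (P.v i)) ∧
      (∀ y ∈ interior P.region, dt ν y < dt ν (P.v i)) := by
  set m := midpoint ℝ (P.v i) (P.v (i + 1)) with hm
  have hm0 : m ∉ interior P.region := P.edge_frontier i (midpoint_mem_segment _ _)
  obtain ⟨f, hf⟩ := geometric_hahn_banach_open_point P.convex_region.interior isOpen_interior hm0
  set g : E2 := (InnerProductSpace.toDual ℝ E2).symm f with hg
  have hfg : ∀ y, f y = dt g y := by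
    intro y
    rw [← inner_eq_dt, hg, InnerProductSpace.toDual_symm_apply]
  have hle : ∀ y ∈ P.region, dt g y ≤ dt g m := by
    intro y hy
    have hy' : y ∈ closure (interior P.region) := by
      rw [P.convex_region.closure_interior_eq_closure_of_nonempty_interior ⟨x, hx⟩]
      exact subset_closure hy
    have hcl : IsClosed {y | f y ≤ f m} := isClosed_le f.continuous continuous_const
    have : y ∈ {y | f y ≤ f m} :=
      closure_minimal (fun z hz => (hf z hz).le) hcl hy'
    rw [← hfg, ← hfg]; exact this
  have hg0 : g ≠ 0 := by
    intro h
    have := hf x hx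
    rw [hfg, hfg, h] at this
    simp [dt] at this
  have hmm : dt g m = (dt g (P.v i) + dt g (P.v (i + 1))) / 2 := by
    have : m = (1 / 2 : ℝ) • (P.v i + P.v (i + 1)) := by
      rw [hm, midpoint_eq_smul_add]; norm_num
    rw [this, dt_smul, dt_add]; ring
  have h1 := hle _ (P.v_mem i)
  have h2 := hle _ (P.v_mem (i + 1))
  have h3 : dt g m = dt g (P.v i) := by linarith
  have hn : 0 < ‖g‖⁻¹ := inv_pos.2 (norm_pos_iff.2 hg0)
  refine ⟨‖g‖⁻¹ • g, ?_, ?_, ?_, ?_⟩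
  · rw [dt_smul_left, dt_smul, ← norm_sq_eq_dt]
    have := norm_ne_zero_iff.2 hg0
    field_simp
  · rw [dt_smul_left, dt_smul_left]; congr 1; linarith
  · intro y hy
    rw [dt_smul_left, dt_smul_left, ← h3]
    exact mul_le_mul_of_nonneg_left (hle y hy) hn.le
  · intro y hy
    rw [dt_smul_left, dt_smul_left, ← h3]
    refine mul_lt_mul_of_pos_left ?_ hn
    rw [← hfg, ← hfg]; exact hf y hy

lemma not_sbtw (i : Fin n) (y z : E2) (hy : y ∈ P.region) (hz : z ∈ P.region)
    (h : Wbtw ℝ y (P.v i) z) (h1 : P.v i ≠ y) (h2 : P.v i ≠ z) : False := by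
  have he := (mem_extremePoints.1 (P.extreme i)).2 y hy z hz
  have hs : Sbtw ℝ y (P.v i) z := ⟨h, h1, h2⟩
  have : P.v i ∈ openSegment ℝ y z := by
    rw [openSegment_eq_image_lineMap]
    have := (sbtw_iff_mem_image_Ioo_and_ne.1 hs).1
    exact this
  exact h1 (he this).1.symm

/-- Three distinct vertices are not collinear. -/
lemma not_collinear (i j k : Fin n) (hij : P.v i ≠ P.v j) (hik : P.v i ≠ P.v k)
    (hjk : P.v j ≠ P.v k) : crs (P.v j - P.v i) (P.v k - P.v i) ≠ 0 := by
  intro h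
  have hc : Collinear ℝ {P.v i, P.v j, P.v k} := by
    rw [collinear_iff_of_mem (p₀ := P.v i) (by simp)]
    set u := P.v j - P.v i with hu
    set w := P.v k - P.v i with hw
    have hu0 : dt u u ≠ 0 := by
      rw [← norm_sq_eq_dt]
      exact pow_ne_zero _ (norm_ne_zero_iff.2 (sub_ne_zero.2 hij.symm))
    refine ⟨u, ?_⟩
    intro p hp
    simp only [Set.mem_insert_iff, Set.mem_singleton_iff] at hp
    rcases hp with rfl | rfl | rfl
    · exact ⟨0, by simp⟩
    · exact ⟨1, by simp [hu]⟩
    · refine ⟨dt u w / dt u u, ?_⟩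
      have : w = (dt u w / dt u u) • u := by
        ext l
        fin_cases l
        · simp only [PiLp.smul_apply, smul_eq_mul]
          field_simp
          simp only [dt, crs] at *
          simp only [Fin.zero_eta, Fin.isValue]
          linear_combination (-(u 1)) * h
        · simp only [PiLp.smul_apply, smul_eq_mul]
          field_simp
          simp only [dt, crs] at *
          simp only [Fin.mk_one, Fin.isValue]
          linear_combination (u 0) * h
      rw [← this, hw]; simp
  rcases hc.wbtw_or_wbtw_or_wbtw with h' | h' | h'
  · exact P.not_sbtw j _ _ (P.v_mem i) (P.v_mem k) h' hij.symm hjk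
  · exact P.not_sbtw k _ _ (P.v_mem j) (P.v_mem i) h' hjk.symm hik.symm
  · exact P.not_sbtw i _ _ (P.v_mem k) (P.v_mem j) h' hik hij

/-- A ball of radius `1/γ*` inside the polygon. -/
lemma exists_ball (γs : ℝ) (hγ : 0 < γs) (hdiam : Metric.diam P.region = 1) (h1 : P.G1 γs)
    (x : E2) (hx : x ∈ interior P.region) :
    ∃ c : E2, Metric.closedBall c (1 / γs) ⊆ P.region := by
  have hbdd : BddAbove {r : ℝ | ∃ c : E2, Metric.closedBall c r ⊆ P.region} := by
    refine ⟨1, ?_⟩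
    rintro r ⟨c, hc⟩
    by_contra hr
    push Not at hr
    have hm1 : c + r • (EuclideanSpace.single 0 1 : E2) ∈ Metric.closedBall c r := by
      simp [norm_smul, abs_of_pos (by linarith : 0 < r)]
    have hm2 : c ∈ Metric.closedBall c r := by simp; linarith
    have := Metric.dist_le_diam_of_mem P.isBounded_region (hc hm1) (hc hm2)
    rw [hdiam] at this
    simp [norm_smul, abs_of_pos (by linarith : 0 < r)] at this
    linarith
  have hpos : 0 < P.inradius := by
    obtain ⟨ε, hε, hb⟩ := Metric.isOpen_iff.1 isOpen_interior x hx
    have : ε / 2 ≤ P.inradius := by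
      apply le_csSup hbdd
      exact ⟨x, (Metric.closedBall_subset_ball (by linarith)).trans (hb.trans interior_subset)⟩
    linarith
  have hlt : 1 / γs < P.inradius := by
    unfold G1 at h1
    rw [hdiam, div_lt_iff₀ hpos] at h1
    rw [div_lt_iff₀ hγ]; linarith
  obtain ⟨r, ⟨c, hc⟩, hr⟩ := exists_lt_of_lt_csSup (by
    exact ⟨-1, 0, by simp⟩) hlt
  exact ⟨c, (Metric.closedBall_subset_closedBall hr.le).trans hc⟩

lemma t_nonneg (i : Fin n) (x : E2) : 0 ≤ P.t i x := tan_half_nonneg _ _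

end ConvexPolygon

namespace ConvexPolygon

variable {n : ℕ} [NeZero n] (P : ConvexPolygon n)

lemma fin_one_ne (hn : 3 ≤ n) : (1 : Fin n) ≠ 0 := by
  intro h
  have := congrArg Fin.val h
  rw [Fin.val_one', Fin.val_zero, Nat.mod_eq_of_lt (by omega)] at this
  omega

lemma fin_two_ne (hn : 3 ≤ n) : (1 + 1 : Fin n) ≠ 0 := by
  intro h
  have := congrArg Fin.val h
  rw [Fin.val_add, Fin.val_one', Fin.val_zero, Nat.mod_eq_of_lt (by omega : 1 < n),
    Nat.mod_eq_of_lt (by omega)] at this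
  omega

lemma dist_le_one (hdiam : Metric.diam P.region = 1) {y z : E2} (hy : y ∈ P.region)
    (hz : z ∈ P.region) : ‖y - z‖ ≤ 1 := by
  rw [← dist_eq_norm, ← hdiam]
  exact Metric.dist_le_diam_of_mem P.isBounded_region hy hz

lemma normal_ball {ρ : ℝ} (hρ : 0 < ρ) {c ν : E2} (hν : dt ν ν = 1)
    (hc : Metric.closedBall c ρ ⊆ P.region) (i : Fin n)
    (h : ∀ y ∈ P.region, dt ν y ≤ dt ν (P.v i)) : dt ν c + ρ ≤ dt ν (P.v i) := by
  have hn : ‖ν‖ = 1 := by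
    have := norm_sq_eq_dt ν
    rw [hν] at this
    exact (pow_eq_one_iff_of_nonneg (norm_nonneg _) two_ne_zero).1 this
  have := h (c + ρ • ν) (hc (by simp [norm_smul, hn, abs_of_pos hρ]))
  rw [dt_add, dt_smul, hν] at this
  linarith

lemma near_upper {ρ d : ℝ} (hρ : 0 < ρ) (hd : 0 < d) (hdiam : Metric.diam P.region = 1)
    (h2 : P.G2 d) {x c : E2} (hx : x ∈ interior P.region)
    (hc : Metric.closedBall c ρ ⊆ P.region) (hd1 : d ≤ 1) (hρ1 : ρ ≤ 1) (a j : Fin n)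
    (hr : P.r a x ≤ ρ * d / 8) (hja : j ≠ a) (hja' : j + 1 ≠ a) :
    P.t j x ≤ 2 / (ρ * d / 8 * d) := by
  obtain ⟨ν, hν, hνe, hνle, hνlt⟩ := P.exists_normal x hx j
  obtain ⟨μ, hμ, -, hμle, -⟩ := P.exists_normal x hx a
  have hxr := interior_subset hx
  have hcr : c ∈ P.region := hc (by simp [hρ.le])
  have hjj : j ≠ j + 1 := by
    intro h
    exact fin_one_ne P.hn (by simpa using h.symm)
  have k1 := h2 j a hja
  have k2 := h2 (j + 1) a hja'
  have k3 := h2 j (j + 1) hjj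
  have hne : ∀ i k, i ≠ k → P.v i ≠ P.v k := fun i k hik h => by
    have := h2 i k hik
    rw [h, dist_self] at this; linarith
  have hnc := P.not_collinear j a (j + 1) (hne _ _ hja) (hne _ _ hjj) (hne _ _ hja'.symm)
  have b1 := P.normal_ball hρ hν hc j hνle
  have b2 := P.normal_ball hρ hμ hc a hμle
  refine upper_geo d ρ hd hd1 hρ hρ1 (P.v j - x) (P.v (j + 1) - x) (P.v a - x) (c - P.v a) ν μ hν hμ
    ?_ ?_ ?_ ?_ ?_ ?_ ?_ ?_ ?_ ?_ ?_ ?_ ?_ ?_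
  · rw [← dist_eq_norm, dist_comm]; exact hr
  · rw [sub_sub_sub_cancel_right, ← dist_eq_norm]; exact k1.le
  · rw [sub_sub_sub_cancel_right, ← dist_eq_norm]; exact k2.le
  · rw [sub_sub_sub_cancel_right, ← dist_eq_norm]; exact k3.le
  · exact P.dist_le_one hdiam (P.v_mem _) hxr
  · exact P.dist_le_one hdiam (P.v_mem _) hxr
  · exact P.dist_le_one hdiam hcr (P.v_mem _)
  · rw [dt_sub, dt_sub, hνe]
  · rw [dt_sub]; linarith [hνle x hxr]
  · rw [dt_sub, dt_sub]
    have : dt ν (P.v a) ≠ dt ν (P.v j) := by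
      intro h
      apply hnc
      rw [crs_frame ν _ _ hν, dt_sub, dt_sub, h, hνe]; ring
    have := lt_of_le_of_ne (hνle _ (P.v_mem a)) this
    linarith
  · simp only [dt_sub]; linarith
  · simp only [dt_sub]; linarith [hμle _ (P.v_mem j)]
  · simp only [dt_sub]; linarith [hμle _ (P.v_mem (j + 1))]
  · simp only [dt_sub]; linarith

lemma near_lower {ρ d : ℝ} (hρ : 0 < ρ) (hd : 0 < d) (hdiam : Metric.diam P.region = 1)
    (h2 : P.G2 d) {x c : E2} (hx : x ∈ interior P.region)
    (hc : Metric.closedBall c ρ ⊆ P.region) (hρ1 : ρ ≤ 1) (a : Fin n)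
    (hr : P.r a x ≤ ρ * d / 8) :
    ρ / 12 ≤ P.t (a - 1) x + P.t a x := by
  obtain ⟨ν, hν, hνe, hνle, hνlt⟩ := P.exists_normal x hx a
  obtain ⟨μ, hμ, hμe, hμle, hμlt⟩ := P.exists_normal x hx (a - 1)
  rw [sub_add_cancel] at hμe
  have ha1 : a - 1 ≠ a := by
    intro h
    exact fin_one_ne P.hn (by simpa using h)
  have ha2 : a + 1 ≠ a := by
    intro h
    exact fin_one_ne P.hn (by simpa using h)
  have ha3 : a - 1 ≠ a + 1 := by
    intro h
    apply fin_two_ne P.hn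
    have : a = a + (1 + 1) := by
      rw [sub_eq_iff_eq_add] at h
      rw [← add_assoc]; exact h
    simpa using this.symm
  have k1 := h2 _ _ ha1
  have k2 := h2 _ _ ha2
  have hne : ∀ i k, i ≠ k → P.v i ≠ P.v k := fun i k hik h => by
    have := h2 i k hik
    rw [h, dist_self] at this; linarith
  have hnc := P.not_collinear a (a - 1) (a + 1) (hne _ _ ha1.symm) (hne _ _ ha2.symm) (hne _ _ ha3)
  have hrd : ρ * d ≤ d := mul_le_of_le_one_left hd.le hρ1
  have key := lower_geo d ρ hρ hρ1 (P.v a - x) (P.v (a - 1) - P.v a) (P.v (a + 1) - P.v a) ν μ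
    (c - P.v a) hν hμ ?_ ?_ ?_ hnc ?_ ?_ ?_ ?_ ?_ ?_ ?_
  · rw [sub_add_sub_cancel, sub_add_sub_cancel, InnerProductGeometry.angle_comm (P.v a - x)
      (P.v (a - 1) - x)] at key
    have e1 : P.t (a - 1) x = tan (InnerProductGeometry.angle (P.v (a - 1) - x) (P.v a - x) / 2) := by
      unfold t angleAt
      rw [sub_add_cancel]; rfl
    rw [e1]; exact key
  · rw [← dist_eq_norm, dist_comm]
    have : P.r a x ≤ d / 4 := by linarith
    exact this
  · rw [← dist_eq_norm]; exact k1.le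
  · rw [← dist_eq_norm]; exact k2.le
  · rw [dt_sub]; linarith
  · rw [dt_sub]; linarith [hνle _ (P.v_mem (a - 1))]
  · rw [dt_sub]; linarith
  · rw [dt_sub]; linarith [hμle _ (P.v_mem (a + 1))]
  · rw [dt_sub]; linarith [hνlt x hx]
  · rw [dt_sub]; linarith [hμlt x hx]
  · intro z hz
    have hm : z + P.v a ∈ P.region := by
      apply hc
      rw [Metric.mem_closedBall, dist_eq_norm]
      have e : z + P.v a - c = z - (c - P.v a) := by abel
      rw [e]; exact hz
    refine ⟨?_, ?_, ?_⟩
    · have := hνle _ hm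
      rw [dt_add] at this; linarith
    · have := hμle _ hm
      rw [dt_add] at this; linarith
    · have := P.dist_le_one hdiam hm (P.v_mem a)
      rwa [add_sub_cancel_right] at this

lemma r_pos {x : E2} (hx : x ∈ interior P.region) (i : Fin n) : 0 < P.r i x := by
  unfold r
  rw [dist_pos]
  rintro rfl
  exact P.edge_frontier i (left_mem_segment ℝ _ _) hx

end ConvexPolygon

open ConvexPolygon in
/-- Lemma 2: under G1 and G2 there is a uniform constant `C₁` bounding
`(t_{a−1}+t_a)(t_{b−1}+t_b)/(r_a² r_b)` by `C₁ (Σ_j w_j)²`. -/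
theorem lemma_one_bound (γstar dstar : ℝ) (hγ : 0 < γstar) (hd : 0 < dstar) :
    ∃ C₁ : ℝ, 0 < C₁ ∧
      ∀ (n : ℕ) [NeZero n] (P : ConvexPolygon n),
        Metric.diam P.region = 1 → P.G1 γstar → P.G2 dstar →
        ∀ x ∈ interior P.region, ∀ a b : Fin n, a ≠ b →
          (P.t (a - 1) x + P.t a x) * (P.t (b - 1) x + P.t b x) / (P.r a x ^ 2 * P.r b x)
            ≤ C₁ * (∑ j : Fin n, P.w j x) ^ 2 := by
  set ρ : ℝ := 1 / γstar with hρd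
  have hρ : 0 < ρ := by positivity
  set δ : ℝ := ρ * dstar / 8 with hδd
  have hδ : 0 < δ := by positivity
  set K : ℝ := 2 / (δ * dstar) with hKd
  have hK : 0 < K := by positivity
  set M : ℝ := 1 + K / (ρ / 12) with hMd
  have hM : 0 < M := by positivity
  refine ⟨1 / δ + 2 / dstar * (2 * M), by positivity, ?_⟩
  intro n _ P hdiam h1 h2 x hx a b hab
  obtain ⟨c, hc⟩ := P.exists_ball γstar hγ hdiam h1 x hx
  have hd1 : dstar ≤ 1 := by
    have := P.dist_le_one hdiam (P.v_mem a) (P.v_mem b)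
    rw [← dist_eq_norm] at this
    exact (h2 a b hab).le.trans this
  have hρ1 : ρ ≤ 1 := by
    have hm1 : c + ρ • (EuclideanSpace.single 0 1 : E2) ∈ Metric.closedBall c ρ := by
      simp [norm_smul, abs_of_pos hρ]
    have hm2 : c ∈ Metric.closedBall c ρ := by simp [hρ.le]
    have := P.dist_le_one hdiam (hc hm1) (hc hm2)
    rwa [add_sub_cancel_left, norm_smul, Real.norm_eq_abs, abs_of_pos hρ,
      EuclideanSpace.norm_single, norm_one, mul_one] at this
  have hw : ∀ j, 0 ≤ P.w j x := fun j =>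
    div_nonneg (add_nonneg (P.t_nonneg _ x) (P.t_nonneg _ x)) (P.r_pos hx j).le
  have hW : ∀ j, P.w j x ≤ ∑ i, P.w i x := fun j =>
    Finset.single_le_sum (f := fun i => P.w i x) (fun i _ => hw i) (Finset.mem_univ j)
  have hra := P.r_pos hx a
  have hrb := P.r_pos hx b
  have hA : P.t (a - 1) x + P.t a x = P.w a x * P.r a x := by
    unfold w; field_simp
  have hB : P.t (b - 1) x + P.t b x = P.w b x * P.r b x := by
    unfold w; field_simp
  set W := ∑ i, P.w i x with hWd
  have hW0 : 0 ≤ W := (hw a).trans (hW a)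
  by_cases hr : P.r a x ≤ δ
  · have hlow := P.near_lower hρ hd hdiam h2 hx hc hρ1 a hr
    have hup : ∀ j, P.t j x ≤ M * (P.t (a - 1) x + P.t a x) := by
      intro j
      have n1 := P.t_nonneg (a - 1) x
      have n2 := P.t_nonneg a x
      have hKA : K ≤ K / (ρ / 12) * (P.t (a - 1) x + P.t a x) := by
        have : K = K / (ρ / 12) * (ρ / 12) := by field_simp
        calc K = K / (ρ / 12) * (ρ / 12) := this
          _ ≤ _ := by gcongr
      by_cases hja : j = a
      · subst hja; rw [hMd]; linarith
      by_cases hja' : j + 1 = a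
      · have : j = a - 1 := eq_sub_of_add_eq hja'
        subst this; rw [hMd]; linarith
      have := P.near_upper hρ hd hdiam h2 hx hc hd1 hρ1 a j hr hja hja'
      rw [hMd]; linarith
    have hb1 := hup (b - 1)
    have hb2 := hup b
    have hrb2 : dstar / 2 ≤ P.r b x := by
      have := h2 a b hab
      have htri := dist_triangle (P.v a) x (P.v b)
      rw [dist_comm (P.v a) x] at htri
      have hrd : ρ * dstar ≤ dstar := mul_le_of_le_one_left hd.le hρ1
      have e1 : P.r a x = dist x (P.v a) := rfl
      have e2 : P.r b x = dist x (P.v b) := rfl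
      linarith
    set A := P.t (a - 1) x + P.t a x with hAd
    have hA0 : 0 ≤ A := by linarith
    calc A * (P.t (b - 1) x + P.t b x) / (P.r a x ^ 2 * P.r b x)
        ≤ A * (2 * M * A) / (P.r a x ^ 2 * (dstar / 2)) := by
          gcongr
          linarith
      _ = 2 / dstar * (2 * M) * (P.w a x) ^ 2 := by
          rw [hA]; field_simp
      _ ≤ 2 / dstar * (2 * M) * W ^ 2 := by
          gcongr
          · exact hw a
          · exact hW a
      _ ≤ _ := by
          have : 0 ≤ 1 / δ * W ^ 2 := by positivity
          linarith
  · push Not at hr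
    rw [hA, hB]
    calc P.w a x * P.r a x * (P.w b x * P.r b x) / (P.r a x ^ 2 * P.r b x)
        = P.w a x * P.w b x / P.r a x := by field_simp
      _ ≤ W * W / δ := by
          gcongr
          · exact hw b
          · exact hW a
          · exact hW b
      _ = 1 / δ * W ^ 2 := by ring
      _ ≤ _ := by
          have : 0 ≤ 2 / dstar * (2 * M) * W ^ 2 := by positivity
          linarith
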